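/- In the graph G' of the dominating-set partitioned-TS-to-partitioned-TJ construction, fix i ∈ {1,…,k}, vertices v, w ∈ P_i, and a δ-vertex δ (either δ_∅ or δ_{xy} for an edge xy of some G[P_j]). Then the three vertices v^a, w^c and δ together dominate all vertices u^b and u^d with u ∈ P_i if and only if v = w, or δ = δ_{vw} where vw is an edge of G[P_i]. -/

import Mathlib

/-- `I` is an independent set of the graph `G`. -/
def IsIndepFinset {α : Type*} (G : SimpleGraph α) (I : Finset α) : Prop :=
  ∀ u ∈ I, ∀ v ∈ I, ¬ G.Adj u v

/-- `D` is a dominating set of the graph `G`. -/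
def IsDomFinset {α : Type*} (G : SimpleGraph α) (D : Finset α) : Prop :=
  ∀ x : α, x ∈ D ∨ ∃ y ∈ D, G.Adj x y

/-- A token-jumping step: some token jumps from `u ∈ I` to `w ∉ I`. -/
def TJStep {α : Type*} [DecidableEq α] (I J : Finset α) : Prop :=
  ∃ u ∈ I, ∃ w, w ∉ I ∧ J = insert w (I.erase u)

/-- A token-sliding step: some token slides from `u ∈ I` along an edge to `w ∉ I`. -/
def TSStep {α : Type*} [DecidableEq α] (G : SimpleGraph α) (I J : Finset α) : Prop :=
  ∃ u ∈ I, ∃ w, w ∉ I ∧ G.Adj u w ∧ J = insert w (I.erase u)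

/-- A partitioned token-jumping step with respect to token sets `Q`. -/
def PTJStep {α : Type*} {ι : Type*} [DecidableEq α] (Q : ι → Set α) (I J : Finset α) : Prop :=
  ∃ u ∈ I, ∃ w, w ∉ I ∧ (∃ i, u ∈ Q i ∧ w ∈ Q i) ∧ J = insert w (I.erase u)

/-- A partitioned token-sliding step with respect to token sets `Q`. -/
def PTSStep {α : Type*} {ι : Type*} [DecidableEq α] (G : SimpleGraph α) (Q : ι → Set α)
    (I J : Finset α) : Prop :=
  ∃ u ∈ I, ∃ w, w ∉ I ∧ G.Adj u w ∧ (∃ i, u ∈ Q i ∧ w ∈ Q i) ∧ J = insert w (I.erase u)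

/-- There is a reconfiguration sequence `A = f 0, f 1, …, f ℓ = B` of length `ℓ`, all of whose
members satisfy `Valid`, with consecutive members related by `Step`. -/
def AdmitsSeq {α : Type*} (Valid : Finset α → Prop) (Step : Finset α → Finset α → Prop)
    (A B : Finset α) (ℓ : ℕ) : Prop :=
  ∃ f : ℕ → Finset α, f 0 = A ∧ f ℓ = B ∧ (∀ i, i ≤ ℓ → Valid (f i)) ∧
    ∀ i, i < ℓ → Step (f i) (f (i + 1))

/-- The edges of the induced subgraphs `G[P_i]`, indexing the `δ_{vw}`-vertices. -/
abbrev PartEdge {V : Type*} (G : SimpleGraph V) {k : ℕ} (P : Fin k → Finset V) : Type _ :=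
  {e : Sym2 V // e ∈ G.edgeSet ∧ ∃ i, ∀ x ∈ e, x ∈ P i}

/-- Vertices of the graph `G'` of the dominating-set partitioned-TS-to-partitioned-TJ
construction. -/
inductive GVsix (V : Type*) (Ed : Type*) : Type _ where
  | a : V → GVsix V Ed
  | b : V → GVsix V Ed
  | c : V → GVsix V Ed
  | d : V → GVsix V Ed
  | de : Ed → GVsix V Ed   -- δ_{vw}
  | d0 : GVsix V Ed        -- δ_∅
  | orig : V → GVsix V Ed  -- v'
  | zdom : GVsix V Ed
deriving DecidableEq

/-- The edges of `G'`. -/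
def relSix {V : Type*} (G : SimpleGraph V) {k : ℕ} (P : Fin k → Finset V) :
    GVsix V (PartEdge G P) → GVsix V (PartEdge G P) → Prop
  | .a v, .b w => v = w
  | .c v, .d w => v = w
  | .a v, .d w => v ≠ w ∧ ∃ i, v ∈ P i ∧ w ∈ P i
  | .c v, .b w => v ≠ w ∧ ∃ i, v ∈ P i ∧ w ∈ P i
  | .a v, .a w => ∃ i, v ∈ P i ∧ w ∈ P i
  | .c v, .c w => ∃ i, v ∈ P i ∧ w ∈ P i
  | .de e, .b v => v ∈ e.val
  | .de e, .d v => v ∈ e.val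
  | .de _, .de _ => True
  | .de _, .d0 => True
  | .orig v, .a w => G.Adj v w ∨ v = w
  | _, _ => False

/-- The graph `G'` of the dominating-set partitioned-TS-to-partitioned-TJ construction. -/
def GpSix {V : Type*} (G : SimpleGraph V) {k : ℕ} (P : Fin k → Finset V) :
    SimpleGraph (GVsix V (PartEdge G P)) :=
  SimpleGraph.fromRel (relSix G P)

/-- A set `S` of vertices dominates a vertex `x` if `x ∈ S` or `x` is adjacent to a vertex
of `S`. -/
def DominatesVert {α : Type*} (G : SimpleGraph α) (S : Set α) (x : α) : Prop :=
  x ∈ S ∨ ∃ y ∈ S, G.Adj x y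

section Adjacency

variable {V : Type*} (G : SimpleGraph V) {k : ℕ} (P : Fin k → Finset V)

lemma GpSix_adj_b_a (u v : V) :
    (GpSix G P).Adj (.b u) (.a v) ↔ v = u :=
  ⟨fun h => h.2.elim False.elim id, fun h => ⟨nofun, Or.inr h⟩⟩

lemma GpSix_adj_b_c (u v : V) :
    (GpSix G P).Adj (.b u) (.c v) ↔ v ≠ u ∧ ∃ i, v ∈ P i ∧ u ∈ P i :=
  ⟨fun h => h.2.elim False.elim id, fun h => ⟨nofun, Or.inr h⟩⟩

lemma GpSix_adj_b_de (u : V) (e : PartEdge G P) :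
    (GpSix G P).Adj (.b u) (.de e) ↔ u ∈ e.val :=
  ⟨fun h => h.2.elim False.elim id, fun h => ⟨nofun, Or.inr h⟩⟩

lemma GpSix_adj_b_d0 (u : V) :
    (GpSix G P).Adj (.b u) .d0 ↔ False :=
  ⟨fun h => h.2.elim False.elim id, fun h => ⟨nofun, Or.inr h⟩⟩

lemma GpSix_adj_d_a (u v : V) :
    (GpSix G P).Adj (.d u) (.a v) ↔ v ≠ u ∧ ∃ i, v ∈ P i ∧ u ∈ P i :=
  ⟨fun h => h.2.elim False.elim id, fun h => ⟨nofun, Or.inr h⟩⟩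

lemma GpSix_adj_d_c (u v : V) :
    (GpSix G P).Adj (.d u) (.c v) ↔ v = u :=
  ⟨fun h => h.2.elim False.elim id, fun h => ⟨nofun, Or.inr h⟩⟩

lemma GpSix_adj_d_de (u : V) (e : PartEdge G P) :
    (GpSix G P).Adj (.d u) (.de e) ↔ u ∈ e.val :=
  ⟨fun h => h.2.elim False.elim id, fun h => ⟨nofun, Or.inr h⟩⟩

lemma GpSix_adj_d_d0 (u : V) :
    (GpSix G P).Adj (.d u) .d0 ↔ False :=
  ⟨fun h => h.2.elim False.elim id, fun h => ⟨nofun, Or.inr h⟩⟩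

end Adjacency

lemma dominatesVert_b_iff {V : Type*} (G : SimpleGraph V) {k : ℕ} (P : Fin k → Finset V)
    {i : Fin k} {v w u : V} (hw : w ∈ P i) (hu : u ∈ P i)
    {δ : GVsix V (PartEdge G P)} (hδ : δ = GVsix.d0 ∨ ∃ e : PartEdge G P, δ = GVsix.de e) :
    DominatesVert (GpSix G P) {GVsix.a v, GVsix.c w, δ} (GVsix.b u) ↔
      u = v ∨ u ≠ w ∨ ∃ e : PartEdge G P, δ = GVsix.de e ∧ u ∈ e.val := by
  have hi : ∃ j, w ∈ P j ∧ u ∈ P j := ⟨i, hw, hu⟩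
  rcases hδ with rfl | ⟨e, rfl⟩ <;>
    simp [DominatesVert, GpSix_adj_b_a, GpSix_adj_b_c, GpSix_adj_b_de, GpSix_adj_b_d0,
      hi, eq_comm, -Subtype.exists]

lemma dominatesVert_d_iff {V : Type*} (G : SimpleGraph V) {k : ℕ} (P : Fin k → Finset V)
    {i : Fin k} {v w u : V} (hv : v ∈ P i) (hu : u ∈ P i)
    {δ : GVsix V (PartEdge G P)} (hδ : δ = GVsix.d0 ∨ ∃ e : PartEdge G P, δ = GVsix.de e) :
    DominatesVert (GpSix G P) {GVsix.a v, GVsix.c w, δ} (GVsix.d u) ↔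
      u ≠ v ∨ u = w ∨ ∃ e : PartEdge G P, δ = GVsix.de e ∧ u ∈ e.val := by
  have hi : ∃ j, v ∈ P j ∧ u ∈ P j := ⟨i, hv, hu⟩
  rcases hδ with rfl | ⟨e, rfl⟩ <;>
    simp [DominatesVert, GpSix_adj_d_a, GpSix_adj_d_c, GpSix_adj_d_de, GpSix_adj_d_d0,
      hi, eq_comm, -Subtype.exists]

/-- for `v, w ∈ P_i` and a `δ`-vertex `δ`, the three vertices `v^a`, `w^c` and
`δ` together dominate all vertices `u^b` and `u^d` with `u ∈ P_i` iff `v = w`, or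
`δ = δ_{vw}` where `vw` is an edge of `G[P_i]`. -/
theorem stmt16 {V : Type*} [Fintype V] [DecidableEq V] (G : SimpleGraph V) (k : ℕ)
    (P : Fin k → Finset V) (hP : ∀ v : V, ∃! i, v ∈ P i)
    (i : Fin k) (v w : V) (hv : v ∈ P i) (hw : w ∈ P i)
    (δ : GVsix V (PartEdge G P))
    (hδ : δ = GVsix.d0 ∨ ∃ e : PartEdge G P, δ = GVsix.de e) :
    (∀ u ∈ P i,
        DominatesVert (GpSix G P) {GVsix.a v, GVsix.c w, δ} (GVsix.b u) ∧
        DominatesVert (GpSix G P) {GVsix.a v, GVsix.c w, δ} (GVsix.d u)) ↔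
    (v = w ∨ ∃ e : PartEdge G P, δ = GVsix.de e ∧ e.val = s(v, w)) := by
  constructor
  · intro h
    by_cases hvw : v = w
    · exact Or.inl hvw
    obtain ⟨e, rfl, hwe⟩ : ∃ e : PartEdge G P, δ = GVsix.de e ∧ w ∈ e.val := by
      rcases (dominatesVert_b_iff G P hw hw hδ).1 (h w hw).1 with h | h | h
      · exact absurd h.symm hvw
      · exact absurd rfl h
      · exact h
    obtain ⟨e', he', hve⟩ : ∃ e' : PartEdge G P, GVsix.de e = GVsix.de e' ∧ v ∈ e'.val := by
      rcases (dominatesVert_d_iff G P hv hv hδ).1 (h v hv).2 with h | h | h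
      · exact absurd rfl h
      · exact absurd h hvw
      · exact h
    obtain rfl : e = e' := GVsix.de.inj he'
    exact Or.inr ⟨e, rfl, (Sym2.mem_and_mem_iff hvw).1 ⟨hve, hwe⟩⟩
  · intro h u hu
    rw [dominatesVert_b_iff G P hw hu hδ, dominatesVert_d_iff G P hv hu hδ]
    rcases h with rfl | ⟨e, rfl, he⟩
    · tauto
    · have hv' : v ∈ e.val := he ▸ Sym2.mem_mk_left v w
      have hw' : w ∈ e.val := he ▸ Sym2.mem_mk_right v w
      constructor
      · by_cases huw : u = w
        · exact Or.inr (Or.inr ⟨e, rfl, huw ▸ hw'⟩)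
        · exact Or.inr (Or.inl huw)
      · by_cases huv : u = v
        · exact Or.inr (Or.inr ⟨e, rfl, huv ▸ hv'⟩)
        · exact Or.inl huv
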